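/- Let q ≥ 2 and r = q^l with l ≥ 1. For any m ≥ 1, |Reg_q(mqr)| > (mq)^{r-1} · |Cyc_{q,r}(mqr)|. -/

import Mathlib

/-- Membership in `Cyc_{q,r}(n)`: every cycle length is a multiple of `q` and
each cycle length occurs a multiple of `r` times. -/
def CycQR (q r : ℕ) {α : Type*} [Fintype α] [DecidableEq α] (σ : Equiv.Perm α) : Prop :=
  (∀ x, q ∣ Function.minimalPeriod ⇑σ x) ∧
    ∀ i : ℕ, r ∣ Multiset.count i σ.cycleType

/-- The weight `∏ i ∈ s, x i / (∏ i ∈ s, i * ∏ j, (count j s)!)` of a multiset `s`. When `s` is a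
partition of `n` and `x = 1`, this is the proportion of permutations with cycle lengths `s`. -/
noncomputable def cycleWeight (x : ℕ → ℚ) (s : Multiset ℕ) : ℚ :=
  (s.map x).prod / (s.prod * ∏ i ∈ s.toFinset, (s.count i).factorial : ℕ)

/-- The total weight of the partitions of `n`: the cycle index of the symmetric group. -/
noncomputable def cycleIndex (x : ℕ → ℚ) (n : ℕ) : ℚ :=
  ∑ p : n.Partition, cycleWeight x p.parts

theorem prod_factorial_count_of_subset {s : Multiset ℕ} {t : Finset ℕ} (h : s.toFinset ⊆ t) :
    ∏ i ∈ s.toFinset, (s.count i).factorial = ∏ i ∈ t, (s.count i).factorial := by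
  refine Finset.prod_subset h fun i _ hi => ?_
  rw [Multiset.mem_toFinset] at hi
  simp [Multiset.count_eq_zero_of_notMem hi]

theorem prod_factorial_count_cons (a : ℕ) (s : Multiset ℕ) :
    ∏ i ∈ (a ::ₘ s).toFinset, ((a ::ₘ s).count i).factorial =
      (s.count a + 1) * ∏ i ∈ s.toFinset, (s.count i).factorial := by
  have ha : a ∈ (a ::ₘ s).toFinset := by simp
  rw [prod_factorial_count_of_subset (s := s) (t := (a ::ₘ s).toFinset) (by simp),
    ← Finset.mul_prod_erase _ _ ha, ← Finset.mul_prod_erase _ _ ha, ← mul_assoc,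
    Multiset.count_cons_self, Nat.factorial_succ]
  congr 1
  refine Finset.prod_congr rfl fun i hi => ?_
  rw [Multiset.count_cons_of_ne (Finset.ne_of_mem_erase hi)]

theorem mul_count_mul_cycleWeight (x : ℕ → ℚ) {s : Multiset ℕ} {a : ℕ} (has : a ∈ s)
    (ha : a ≠ 0) : (a * s.count a : ℕ) * cycleWeight x s = x a * cycleWeight x (s.erase a) := by
  obtain ⟨t, rfl⟩ := Multiset.exists_cons_of_mem has
  rw [Multiset.erase_cons_head, cycleWeight, cycleWeight, prod_factorial_count_cons]
  simp only [Multiset.map_cons, Multiset.prod_cons, Multiset.count_cons_self]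
  have ha' : (a : ℚ) ≠ 0 := by exact_mod_cast ha
  have hc : (t.count a + 1 : ℚ) ≠ 0 := by positivity
  push_cast
  rw [mul_div_assoc', mul_div_assoc',
    show (a : ℚ) * (t.map Nat.cast).prod * ((t.count a + 1) * ∏ i ∈ t.toFinset, ((t.count i).factorial : ℚ)) =
      (a * (t.count a + 1)) * ((t.map Nat.cast).prod * ∏ i ∈ t.toFinset, ((t.count i).factorial : ℚ)) by ring,
    mul_div_mul_left _ _ (mul_ne_zero ha' hc)]

theorem cycleIndex_zero (x : ℕ → ℚ) : cycleIndex x 0 = 1 := by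
  simp [cycleIndex, cycleWeight]

theorem sum_mul_count_mul_cycleWeight (x : ℕ → ℚ) {n a : ℕ} (ha : 1 ≤ a) (han : a ≤ n) :
    ∑ p : n.Partition, (a * p.parts.count a : ℕ) * cycleWeight x p.parts =
      x a * cycleIndex x (n - a) := by
  classical
  rw [← Finset.sum_filter_of_ne (p := fun p : n.Partition => a ∈ p.parts), cycleIndex,
    Finset.mul_sum, Finset.sum_subtype (p := fun p : n.Partition => a ∈ p.parts) _ (by simp)]
  · refine Fintype.sum_equiv (Nat.Partition.partitionWithPartEquiv ha han) _ _ fun p => ?_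
    rw [mul_count_mul_cycleWeight x p.2 (by lia),
      Nat.Partition.partitionWithPartEquiv_apply_parts]
  · intro p _ hp
    contrapose! hp
    simp [Multiset.count_eq_zero_of_notMem hp]

theorem mul_cycleIndex (x : ℕ → ℚ) (n : ℕ) :
    n * cycleIndex x n = ∑ j ∈ Finset.range n, x (n - j) * cycleIndex x j := by
  have h (p : n.Partition) : n = ∑ a ∈ Finset.Icc 1 n, a * p.parts.count a := by
    conv_lhs => rw [← p.parts_sum, Finset.sum_multiset_count]
    simp only [smul_eq_mul, mul_comm]
    refine Finset.sum_subset (fun a ha => ?_) fun a _ ha => ?_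
    · rw [Multiset.mem_toFinset] at ha
      exact Finset.mem_Icc.2 ⟨p.parts_pos ha, Nat.Partition.le_of_mem_parts ha⟩
    · rw [Multiset.mem_toFinset] at ha
      simp [Multiset.count_eq_zero_of_notMem ha]
  calc n * cycleIndex x n
      = ∑ p : n.Partition, ∑ a ∈ Finset.Icc 1 n,
          (a * p.parts.count a : ℕ) * cycleWeight x p.parts := by
        rw [cycleIndex, Finset.mul_sum]
        refine Finset.sum_congr rfl fun p _ => ?_
        rw [← Finset.sum_mul, ← Nat.cast_sum, ← h p]
    _ = ∑ a ∈ Finset.Icc 1 n, x a * cycleIndex x (n - a) := by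
        rw [Finset.sum_comm]
        refine Finset.sum_congr rfl fun a ha => ?_
        rw [Finset.mem_Icc] at ha
        exact sum_mul_count_mul_cycleWeight x ha.1 ha.2
    _ = _ := by
        refine Finset.sum_bij' (fun a _ => n - a) (fun j _ => n - j) ?_ ?_ ?_ ?_ ?_ <;>
          simp only [Finset.mem_Icc, Finset.mem_range] <;> intro a ha
        any_goals lia
        rw [Nat.sub_sub_self ha.2]

theorem cycleIndex_const (x : ℚ) (n : ℕ) :
    cycleIndex (fun _ => x) n = ∏ i ∈ Finset.range n, ((i + x) / (i + 1)) := by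
  induction n with
  | zero => simp [cycleIndex_zero]
  | succ n ih =>
    have h1 := mul_cycleIndex (fun _ => x) (n + 1)
    have h0 := mul_cycleIndex (fun _ => x) n
    rw [Finset.sum_range_succ, ← h0] at h1
    rw [Finset.prod_range_succ, ← ih]
    have : (n + 1 : ℚ) ≠ 0 := by positivity
    push_cast at h1
    field_simp
    linear_combination h1

/-- The weight marking the cycle lengths that are not divisible by `q`. -/
def regWeight (q i : ℕ) : ℚ := if q ∣ i then 0 else 1

/-- The proportion of `q`-regular permutations of `q * k` points. -/
def regProd (q k : ℕ) : ℚ := ∏ i ∈ Finset.range k, (1 - 1 / (q * (i + 1)))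

theorem sum_regWeight_mul_regProd {q : ℕ} (hq : 2 ≤ q) (k s : ℕ) (hs : s < q) :
    ∑ j ∈ Finset.range (q * k + s), regWeight q (q * k + s - j) * regProd q (j / q) =
      (q * k + s) * regProd q k := by
  have hq0 : (q : ℚ) ≠ 0 := by positivity
  induction k with
  | zero =>
    rw [Finset.sum_congr rfl (g := fun _ => 1)]
    · simp [regProd]
    · intro j hj
      rw [Finset.mem_range] at hj
      rw [regWeight, if_neg (Nat.not_dvd_of_pos_of_lt (by lia) (by lia)),
        Nat.div_eq_of_lt (by lia)]
      simp [regProd]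
  | succ k ih =>
    have hp : regProd q (k + 1) = regProd q k * (1 - 1 / (q * (k + 1))) := by
      simp [regProd, Finset.prod_range_succ]
    have e1 : ∑ j ∈ Finset.range (q * k + s),
        regWeight q (q * (k + 1) + s - j) * regProd q (j / q) = (q * k + s) * regProd q k := by
      rw [← ih]
      refine Finset.sum_congr rfl fun j hj => ?_
      rw [Finset.mem_range] at hj
      rw [show q * (k + 1) + s - j = (q * k + s - j) + q by rw [mul_add]; lia]
      simp [regWeight]
    have e2 : ∑ t ∈ Finset.range q, regWeight q (q * (k + 1) + s - (q * k + s + t)) *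
        regProd q ((q * k + s + t) / q) =
        (q - 1 - s) * regProd q k + s * regProd q (k + 1) := by
      obtain ⟨d, rfl⟩ : ∃ d, q = d + 1 + s := ⟨q - 1 - s, by lia⟩
      rw [Finset.sum_range_add, Finset.sum_range_succ']
      have h1 : regWeight (d + 1 + s)
          ((d + 1 + s) * (k + 1) + s - ((d + 1 + s) * k + s + 0)) = 0 := by
        rw [show (d + 1 + s) * (k + 1) + s - ((d + 1 + s) * k + s + 0) = d + 1 + s by
          rw [mul_add]; lia]
        simp [regWeight]
      rw [h1, Finset.sum_congr rfl (g := fun _ => regProd (d + 1 + s) k),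
        Finset.sum_congr (s₁ := Finset.range s) rfl (g := fun _ => regProd (d + 1 + s) (k + 1))]
      · simp only [Finset.sum_const, Finset.card_range, nsmul_eq_mul]
        push_cast
        ring
      · intro t ht
        rw [Finset.mem_range] at ht
        rw [regWeight, if_neg, one_mul, show (d + 1 + s) * k + s + (d + 1 + t) =
          t + (d + 1 + s) * (k + 1) by ring, Nat.add_mul_div_left _ _ (by lia),
          Nat.div_eq_of_lt (by lia), zero_add]
        exact Nat.not_dvd_of_pos_of_lt (by rw [mul_add]; lia) (by rw [mul_add]; lia)
      · intro t ht
        rw [Finset.mem_range] at ht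
        rw [regWeight, if_neg, one_mul, show (d + 1 + s) * k + s + (t + 1) =
          (s + (t + 1)) + (d + 1 + s) * k by ring, Nat.add_mul_div_left _ _ (by lia),
          Nat.div_eq_of_lt (by lia), zero_add]
        exact Nat.not_dvd_of_pos_of_lt (by rw [mul_add]; lia) (by rw [mul_add]; lia)
    have e3 : Finset.range (q * (k + 1) + s) = Finset.range (q * k + s + q) := by
      congr 1; ring
    rw [e3, Finset.sum_range_add, e1, e2, hp]
    have : (k + 1 : ℚ) ≠ 0 := by positivity
    push_cast
    field_simp
    ring

theorem cycleIndex_regWeight {q : ℕ} (hq : 2 ≤ q) (n : ℕ) :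
    cycleIndex (regWeight q) n = regProd q (n / q) := by
  induction n using Nat.strong_induction_on with
  | _ n ih =>
    rcases Nat.eq_zero_or_pos n with rfl | hn
    · simp [cycleIndex_zero, regProd]
    · have h := sum_regWeight_mul_regProd hq (n / q) (n % q) (Nat.mod_lt _ (by lia))
      have hc : (q * (n / q : ℕ) + (n % q : ℕ) : ℚ) = n := by exact_mod_cast Nat.div_add_mod n q
      rw [Nat.div_add_mod, hc] at h
      refine mul_left_cancel₀ (by positivity : (n : ℚ) ≠ 0) ?_
      rw [← h, mul_cycleIndex]
      refine Finset.sum_congr rfl fun j hj => ?_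
      rw [ih j (Finset.mem_range.1 hj)]

theorem cycleIndex_const_lt_regProd {q r m : ℕ} (hq : 2 ≤ q) (hr : 2 ≤ r) (hm : 1 ≤ m) :
    cycleIndex (fun _ => 1 / (r.factorial : ℚ)) m < q * regProd q (m * r) := by
  set x : ℚ := 1 / (r.factorial : ℚ) with hx
  have hq' : (2 : ℚ) ≤ q := by exact_mod_cast hq
  have hr' : (2 : ℚ) ≤ r := by exact_mod_cast hr
  have hrf : (r : ℚ) ≤ r.factorial := by exact_mod_cast Nat.self_le_factorial r
  have hx0 : 0 < x := by positivity
  have hxr : x * r ≤ 1 := by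
    rw [hx, one_div_mul_eq_div, div_le_one (by positivity)]; exact hrf
  have hq1 : 1 / (q : ℚ) ≤ 1 / 2 := one_div_le_one_div_of_le (by norm_num) hq'
  have hx2 : x ≤ 1 / 2 := by nlinarith
  have step (i : ℕ) : (1 - 1 / (q * (i + 1)) : ℚ) = (i + 1 - 1 / q) / (i + 1) := by
    field_simp
  have pos (k : ℕ) : 0 < regProd q k := by
    refine Finset.prod_pos fun i _ => ?_
    rw [step]
    have : (0 : ℚ) ≤ i := by positivity
    exact div_pos (by linarith) (by positivity)
  have succ (k : ℕ) : regProd q (k + 1) = regProd q k * ((k + 1 - 1 / q) / (k + 1)) := by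
    rw [← step]; simp [regProd, Finset.prod_range_succ]
  have mono : StrictMono fun k : ℕ => k * regProd q k := by
    refine strictMono_nat_of_lt_succ fun k => ?_
    have h1 : ((k + 1 : ℕ) : ℚ) * regProd q (k + 1) = (k + 1 - 1 / q) * regProd q k := by
      rw [succ]; push_cast; field_simp
    rw [h1]
    exact mul_lt_mul_of_pos_right (by linarith) (pos k)
  have key : ∀ k : ℕ, (1 - 1 / q) * cycleIndex (fun _ => x) (k + 1) ≤ x * regProd q (k + 1) := by
    intro k
    simp only [cycleIndex_const]
    induction k with
    | zero => simp [regProd]; linarith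
    | succ k ih =>
      rw [Finset.prod_range_succ, succ, ← mul_assoc, ← mul_assoc]
      have hk : (0 : ℚ) ≤ k := by positivity
      refine mul_le_mul ih ?_ (by positivity) (mul_nonneg hx0.le (pos _).le)
      push_cast
      gcongr
      linarith
  obtain ⟨k, rfl⟩ : ∃ k, m = k + 1 := ⟨m - 1, by lia⟩
  have h1 := key k
  have h2 : ((k + 1 : ℕ) : ℚ) * regProd q (k + 1) <
      ((k + 1) * r : ℕ) * regProd q ((k + 1) * r) := mono (by nlinarith)
  push_cast at h2
  have h3 : regProd q (k + 1) < r * regProd q ((k + 1) * r) := by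
    rw [mul_assoc] at h2
    exact lt_of_mul_lt_mul_left h2 (by positivity)
  have h4 : x * regProd q (k + 1) < regProd q ((k + 1) * r) := by
    have := pos ((k + 1) * r)
    nlinarith
  have h5 : 0 ≤ cycleIndex (fun _ => x) (k + 1) := by
    rw [cycleIndex_const]; positivity
  have h6 : cycleIndex (fun _ => x) (k + 1) ≤
      q * ((1 - 1 / q) * cycleIndex (fun _ => x) (k + 1)) := by
    have : (q : ℚ) * ((1 - 1 / q) * cycleIndex (fun _ => x) (k + 1)) =
      (q - 1) * cycleIndex (fun _ => x) (k + 1) := by field_simp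
    rw [this]
    nlinarith
  calc _ ≤ _ := h6
    _ < _ := mul_lt_mul_of_pos_left (h1.trans_lt h4) (by positivity)

section Perm

open Equiv.Perm

variable {α : Type*} [Fintype α] [DecidableEq α]

theorem minimalPeriod_eq_card_support_cycleOf {σ : Equiv.Perm α} {x : α} (hx : σ x ≠ x) :
    Function.minimalPeriod σ x = (σ.cycleOf x).support.card := by
  rw [← (isCycle_cycleOf σ hx).orderOf]
  have hx' : σ.cycleOf x x ≠ x := by rwa [cycleOf_apply_self]
  have h (n : ℕ) : Function.IsPeriodicPt σ n x ↔ σ.cycleOf x ^ n = 1 := by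
    rw [(isCycle_cycleOf σ hx).pow_eq_one_iff' hx', cycleOf_pow_apply_self,
      Function.IsPeriodicPt, Function.IsFixedPt, iterate_eq_pow]
  refine Nat.dvd_antisymm ?_ ?_
  · rw [← Function.isPeriodicPt_iff_minimalPeriod_dvd, h, pow_orderOf_eq_one]
  · rw [orderOf_dvd_iff_pow_eq_one, ← h]
    exact Function.isPeriodicPt_minimalPeriod _ _

theorem mem_parts_partition_iff {σ : Equiv.Perm α} {i : ℕ} :
    i ∈ σ.partition.parts ↔ ∃ x, Function.minimalPeriod σ x = i := by
  rw [parts_partition, Multiset.mem_add]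
  constructor
  · rintro (h | h)
    · rw [cycleType_def, Multiset.mem_map] at h
      obtain ⟨c, hc, rfl⟩ := h
      have hc' : c ∈ σ.cycleFactorsFinset := hc
      obtain ⟨x, hx⟩ := (mem_cycleFactorsFinset_iff.1 hc').1.nonempty_support
      refine ⟨x, ?_⟩
      have hσx : σ x ≠ x := mem_support.1 (mem_cycleFactorsFinset_support_le hc' hx)
      rw [minimalPeriod_eq_card_support_cycleOf hσx, ← cycle_is_cycleOf hx hc']
      rfl
    · rw [Multiset.mem_replicate] at h
      obtain ⟨h0, rfl⟩ := h
      have : ∃ x, x ∉ σ.support := by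
        by_contra! hall
        rw [Finset.eq_univ_iff_forall.2 hall, Finset.card_univ] at h0
        lia
      obtain ⟨x, hx⟩ := this
      exact ⟨x, Function.minimalPeriod_eq_one_iff_isFixedPt.2 (notMem_support.1 hx)⟩
  · rintro ⟨x, rfl⟩
    by_cases hx : σ x = x
    · right
      rw [Function.minimalPeriod_eq_one_iff_isFixedPt.2 hx, Multiset.mem_replicate]
      refine ⟨?_, rfl⟩
      have : σ.support.card < Fintype.card α :=
        Finset.card_lt_univ_of_notMem (notMem_support.2 hx)
      lia
    · left
      rw [minimalPeriod_eq_card_support_cycleOf hx, cycleType_def, Multiset.mem_map]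
      exact ⟨σ.cycleOf x, cycleOf_mem_cycleFactorsFinset_iff.2 (mem_support.2 hx), rfl⟩

theorem prod_factorial_count_add_replicate_one {s : Multiset ℕ} (hs : 1 ∉ s) (k : ℕ) :
    ∏ i ∈ (s + Multiset.replicate k 1).toFinset,
        ((s + Multiset.replicate k 1).count i).factorial =
      k.factorial * ∏ i ∈ s.toFinset, (s.count i).factorial := by
  induction k with
  | zero => simp
  | succ k ih =>
    rw [Multiset.replicate_succ, Multiset.add_cons, prod_factorial_count_cons, ih,
      Multiset.count_add, Multiset.count_eq_zero_of_notMem hs, Multiset.count_replicate_self,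
      Nat.factorial_succ, zero_add, mul_assoc]

theorem partition_eq_iff_cycleType {σ : Equiv.Perm α} {p : (Fintype.card α).Partition} :
    σ.partition = p ↔ σ.cycleType = p.parts.filter (2 ≤ ·) := by
  refine ⟨fun h => h ▸ filter_parts_partition_eq_cycleType.symm, fun h => ?_⟩
  have hp (p : (Fintype.card α).Partition) : p.parts = p.parts.filter (2 ≤ ·) +
      Multiset.replicate (Fintype.card α - (p.parts.filter (2 ≤ ·)).sum) 1 := by
    have h1 : p.parts.filter (¬ 2 ≤ ·) =
        Multiset.replicate (Multiset.card (p.parts.filter (¬ 2 ≤ ·))) 1 := by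
      refine Multiset.eq_replicate_card.2 fun b hb => ?_
      rw [Multiset.mem_filter] at hb
      have := p.parts_pos hb.1
      lia
    have h2 := congrArg Multiset.sum (Multiset.filter_add_not (2 ≤ ·) p.parts)
    rw [Multiset.sum_add, p.parts_sum, h1, Multiset.sum_replicate, smul_eq_mul, mul_one] at h2
    rw [← Nat.eq_sub_of_add_eq' h2, ← h1, Multiset.filter_add_not]
  refine Nat.Partition.ext ?_
  rw [hp p, hp σ.partition, filter_parts_partition_eq_cycleType, h]

theorem card_partition_eq (p : (Fintype.card α).Partition) :
    ((Finset.univ.filter fun σ : Equiv.Perm α => σ.partition = p).card : ℚ) =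
      (Fintype.card α).factorial * cycleWeight (fun _ => 1) p.parts := by
  set s := p.parts.filter (2 ≤ ·) with hs
  have hs2 : ∀ a ∈ s, 2 ≤ a := fun a ha => (Multiset.mem_filter.1 ha).2
  have hsum : s.sum ≤ Fintype.card α := by
    conv_rhs => rw [← p.parts_sum, ← Multiset.filter_add_not (2 ≤ ·) p.parts, Multiset.sum_add]
    exact Nat.le_add_right _ _
  have hcount := card_of_cycleType_mul_eq α s
  rw [if_pos ⟨hsum, hs2⟩] at hcount
  obtain ⟨σ, hσ⟩ := (exists_with_cycleType_iff α).2 ⟨hsum, hs2⟩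
  have hp : p.parts = s + Multiset.replicate (Fintype.card α - s.sum) 1 := by
    rw [← partition_eq_iff_cycleType.2 hσ, parts_partition, ← sum_cycleType, hσ]
  have h1 : 1 ∉ s := fun h => absurd (hs2 1 h) (by norm_num)
  have hpos : p.parts.prod * ∏ i ∈ p.parts.toFinset, (p.parts.count i).factorial ≠ 0 := by
    refine mul_ne_zero (Multiset.prod_ne_zero fun h => (p.parts_pos h).ne rfl) ?_
    exact Finset.prod_ne_zero_iff.2 fun i _ => Nat.factorial_ne_zero _
  simp only [partition_eq_iff_cycleType, cycleWeight, Multiset.map_const', Multiset.prod_replicate,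
    one_pow]
  rw [← hs, mul_one_div, eq_div_iff (by exact_mod_cast hpos), ← hcount, hp,
    prod_factorial_count_add_replicate_one h1, Multiset.prod_add, Multiset.prod_replicate]
  push_cast
  ring

theorem cycleWeight_regWeight (q : ℕ) (s : Multiset ℕ) :
    cycleWeight (regWeight q) s =
      if ∀ i ∈ s, ¬ q ∣ i then cycleWeight (fun _ => 1) s else 0 := by
  split_ifs with h
  · have h1 : ∀ i ∈ s, regWeight q i = 1 := fun i hi => if_neg (h i hi)
    rw [cycleWeight, cycleWeight, Multiset.map_congr rfl h1]
  · push Not at h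
    obtain ⟨i, hi, hq⟩ := h
    rw [cycleWeight, Multiset.prod_eq_zero, zero_div]
    exact Multiset.mem_map.2 ⟨i, hi, if_pos hq⟩

theorem card_regular (q : ℕ) :
    (Nat.card {σ : Equiv.Perm α // ∀ x, ¬ q ∣ Function.minimalPeriod σ x} : ℚ) =
      (Fintype.card α).factorial * cycleIndex (regWeight q) (Fintype.card α) := by
  classical
  have h (σ : Equiv.Perm α) : (∀ x, ¬ q ∣ Function.minimalPeriod σ x) ↔
      ∀ i ∈ σ.partition.parts, ¬ q ∣ i := by
    simp [mem_parts_partition_iff]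
  rw [Nat.card_eq_fintype_card, Fintype.card_subtype,
    Finset.card_eq_sum_card_fiberwise (f := Equiv.Perm.partition) (t := Finset.univ) (by simp),
    cycleIndex, Finset.mul_sum, Nat.cast_sum]
  refine Finset.sum_congr rfl fun p _ => ?_
  rw [cycleWeight_regWeight, Finset.filter_filter]
  split_ifs with hp
  · rw [← card_partition_eq]
    congr 2
    ext σ
    simp only [Finset.mem_filter, Finset.mem_univ, true_and, h, and_iff_right_iff_imp]
    rintro rfl
    exact hp
  · rw [mul_zero, Nat.cast_eq_zero, Finset.card_eq_zero, Finset.filter_eq_empty_iff]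
    rintro σ - ⟨h1, rfl⟩
    exact hp ((h σ).1 h1)

theorem CycQR.exists_partition {q r m : ℕ} (hq : 2 ≤ q) (hr : 2 ≤ r)
    (hα : Fintype.card α = m * q * r) {σ : Equiv.Perm α} (h : CycQR q r σ) :
    ∃ p : m.Partition, σ.cycleType = r • p.parts.map (q * ·) := by
  have hparts : ∀ i ∈ σ.partition.parts, q ∣ i := by
    intro i hi
    obtain ⟨x, rfl⟩ := mem_parts_partition_iff.1 hi
    exact h.1 x
  have hsupp : σ.cycleType.sum = m * q * r := by
    rw [sum_cycleType, ← hα]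
    by_contra hne
    have h1 : 1 ∈ σ.partition.parts := by
      rw [parts_partition, Multiset.mem_add, Multiset.mem_replicate]
      have := σ.support.card_le_univ
      exact Or.inr ⟨by lia, rfl⟩
    have := Nat.le_of_dvd one_pos (hparts 1 h1)
    lia
  obtain ⟨t, ht⟩ := Multiset.exists_smul_of_dvd_count σ.cycleType fun a _ => h.2 a
  have hmem : ∀ i ∈ t, i ∈ σ.cycleType := by
    intro i hi
    rw [ht]
    exact (Multiset.mem_nsmul_of_ne_zero (by lia)).2 hi
  have hdvd : ∀ i ∈ t, q ∣ i := fun i hi =>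
    hparts i (by rw [parts_partition]; exact Multiset.mem_add.2 (Or.inl (hmem i hi)))
  have hmap : (t.map (· / q)).map (q * ·) = t := by
    rw [Multiset.map_map]
    conv_rhs => rw [← Multiset.map_id t]
    exact Multiset.map_congr rfl fun i hi => Nat.mul_div_cancel' (hdvd i hi)
  refine ⟨⟨t.map (· / q), ?_, ?_⟩, by rw [hmap, ht]⟩
  · intro i hi
    obtain ⟨j, hj, rfl⟩ := Multiset.mem_map.1 hi
    have := two_le_of_mem_cycleType (hmem j hj)
    exact Nat.div_pos (Nat.le_of_dvd (by lia) (hdvd j hj)) (by lia)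
  · have hsum : t.sum = q * (t.map (· / q)).sum := by
      conv_lhs => rw [← hmap]
      rw [Multiset.sum_map_mul_left, Multiset.map_id']
    rw [ht, Multiset.sum_nsmul, smul_eq_mul, hsum] at hsupp
    have hqr : 0 < q * r := by positivity
    exact Nat.eq_of_mul_eq_mul_left hqr (by linarith)

end Perm

theorem factorial_pow_mul_factorial_le (r j : ℕ) (hr : r ≠ 0) :
    r.factorial ^ j * j.factorial ≤ (r * j).factorial := by
  have h := Nat.uniformBell_mul_eq j hr
  rw [mul_comm j r] at h
  rw [← h, mul_assoc]
  refine Nat.le_mul_of_pos_left _ (Nat.pos_of_ne_zero fun h0 => ?_)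
  simp only [h0, zero_mul] at h
  exact Nat.factorial_ne_zero _ h.symm

theorem Multiset.sum_le_prod_of_two_le {s : Multiset ℕ} (hs : ∀ i ∈ s, 2 ≤ i) :
    s.sum ≤ s.prod := by
  induction s using Multiset.induction with
  | empty => simp
  | cons a s ih =>
    rw [Multiset.forall_mem_cons] at hs
    rw [Multiset.sum_cons, Multiset.prod_cons]
    rcases s.empty_or_exists_mem with rfl | ⟨b, hb⟩
    · simp
    · have h1 := ih hs.2
      have h2 : 2 ≤ s.sum := (hs.2 b hb).trans (Multiset.le_sum_of_mem hb)
      nlinarith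

theorem factorial_pow_card_mul_prod_factorial_count_le {r : ℕ} (hr : r ≠ 0) (s : Multiset ℕ) :
    r.factorial ^ Multiset.card s * ∏ i ∈ s.toFinset, (s.count i).factorial ≤
      ∏ i ∈ (r • s).toFinset, ((r • s).count i).factorial := by
  rw [Multiset.toFinset_nsmul _ _ hr, ← Multiset.toFinset_sum_count_eq s,
    ← Finset.prod_pow_eq_pow_sum, ← Finset.prod_mul_distrib]
  refine Finset.prod_le_prod' fun i _ => ?_
  rw [Multiset.count_nsmul]
  exact factorial_pow_mul_factorial_le r _ hr

theorem prod_factorial_count_map {f : ℕ → ℕ} (hf : Function.Injective f) (s : Multiset ℕ) :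
    ∏ i ∈ (s.map f).toFinset, ((s.map f).count i).factorial =
      ∏ i ∈ s.toFinset, (s.count i).factorial := by
  rw [Multiset.toFinset_map, Finset.prod_image hf.injOn]
  simp only [Multiset.count_map_eq_count' f _ hf]

theorem le_prod_mul_prod_factorial_count_nsmul {q r m : ℕ} (hq : 2 ≤ q) (hr : 2 ≤ r) (hm : 1 ≤ m)
    (p : m.Partition) :
    (m * q) ^ (r - 1) * q * (r.factorial ^ Multiset.card p.parts * (p.parts.prod *
        ∏ i ∈ p.parts.toFinset, (p.parts.count i).factorial)) ≤
      (r • p.parts.map (q * ·)).prod * ∏ i ∈ (r • p.parts.map (q * ·)).toFinset,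
        ((r • p.parts.map (q * ·)).count i).factorial := by
  set M := p.parts.map (q * ·) with hM
  have hsum : m * q = M.sum := by
    rw [hM, Multiset.sum_map_mul_left, Multiset.map_id', p.parts_sum, mul_comm]
  have hprod : M.prod = q ^ Multiset.card p.parts * p.parts.prod := by
    rw [hM, Multiset.prod_map_mul, Multiset.map_const', Multiset.prod_replicate, Multiset.map_id']
  have h2 : ∀ i ∈ M, 2 ≤ i := by
    intro i hi
    obtain ⟨j, hj, rfl⟩ := Multiset.mem_map.1 hi
    have := p.parts_pos hj
    nlinarith
  have hcard : Multiset.card p.parts ≠ 0 := by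
    intro h0
    have h := p.parts_sum
    rw [Multiset.card_eq_zero.1 h0, Multiset.sum_zero] at h
    lia
  have h3 : q * p.parts.prod ≤ M.prod := by
    rw [hprod]
    exact Nat.mul_le_mul_right _ (Nat.le_self_pow hcard q)
  have h4 := factorial_pow_card_mul_prod_factorial_count_le (r := r) (by lia) M
  rw [prod_factorial_count_map (mul_right_injective₀ (by lia : q ≠ 0)), hM,
    Multiset.card_map, ← hM] at h4
  have h5 : (m * q) ^ (r - 1) ≤ M.prod ^ (r - 1) :=
    Nat.pow_le_pow_left (hsum ▸ Multiset.sum_le_prod_of_two_le h2) _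
  have h6 : (r • M).prod = M.prod ^ (r - 1) * M.prod := by
    rw [Multiset.prod_nsmul, pow_sub_one_mul (by lia)]
  rw [h6]
  calc _ = (m * q) ^ (r - 1) * (q * p.parts.prod) * (r.factorial ^ Multiset.card p.parts *
        ∏ i ∈ p.parts.toFinset, (p.parts.count i).factorial) := by ring
    _ ≤ _ := Nat.mul_le_mul (Nat.mul_le_mul h5 h3) h4

section CycBound

variable {α : Type*} [Fintype α] [DecidableEq α]

theorem card_cycleType_nsmul_le {q r m : ℕ} (hq : 2 ≤ q) (hr : 2 ≤ r) (hm : 1 ≤ m)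
    (hα : Fintype.card α = m * q * r) (p : m.Partition) :
    ((m * q) ^ (r - 1) * q : ℚ) * (Finset.univ.filter fun σ : Equiv.Perm α =>
        σ.cycleType = r • p.parts.map (q * ·)).card ≤
      (Fintype.card α).factorial *
        cycleWeight (fun _ => 1 / (r.factorial : ℚ)) p.parts := by
  set M := p.parts.map (q * ·) with hM
  have hsum : (r • M).sum = Fintype.card α := by
    rw [Multiset.sum_nsmul, hM, Multiset.sum_map_mul_left, Multiset.map_id', p.parts_sum, hα,
      smul_eq_mul]
    ring
  have h2 : ∀ i ∈ r • M, 2 ≤ i := by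
    intro i hi
    obtain ⟨j, hj, rfl⟩ := Multiset.mem_map.1 (Multiset.mem_of_mem_nsmul hi)
    have := p.parts_pos hj
    nlinarith
  have hcount := Equiv.Perm.card_of_cycleType_mul_eq α (r • M)
  rw [if_pos ⟨hsum.le, h2⟩, hsum, Nat.sub_self, Nat.factorial_zero, one_mul] at hcount
  have hle := le_prod_mul_prod_factorial_count_nsmul hq hr hm p
  rw [← hM] at hle
  have hpos : p.parts.prod * ∏ i ∈ p.parts.toFinset, (p.parts.count i).factorial ≠ 0 := by
    refine mul_ne_zero (Multiset.prod_ne_zero fun h => (p.parts_pos h).ne rfl) ?_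
    exact Finset.prod_ne_zero_iff.2 fun i _ => Nat.factorial_ne_zero _
  rw [cycleWeight, Multiset.map_const', Multiset.prod_replicate, one_div, inv_pow, ← one_div,
    div_div, mul_one_div, le_div_iff₀ (by positivity), ← hcount]
  exact_mod_cast (by
    calc _ = _ := by ring
      _ ≤ _ := Nat.mul_le_mul_left _ hle :
    (m * q) ^ (r - 1) * q * (Finset.univ.filter fun σ : Equiv.Perm α =>
        σ.cycleType = r • M).card * (r.factorial ^ Multiset.card p.parts * (p.parts.prod *
        ∏ i ∈ p.parts.toFinset, (p.parts.count i).factorial)) ≤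
      (Finset.univ.filter fun σ : Equiv.Perm α => σ.cycleType = r • M).card *
        ((r • M).prod * ∏ i ∈ (r • M).toFinset, ((r • M).count i).factorial))

theorem card_cycQR_le {q r m : ℕ} (hq : 2 ≤ q) (hr : 2 ≤ r) (hm : 1 ≤ m)
    (hα : Fintype.card α = m * q * r) :
    ((m * q) ^ (r - 1) * q : ℚ) * Nat.card {σ : Equiv.Perm α // CycQR q r σ} ≤
      (Fintype.card α).factorial * cycleIndex (fun _ => 1 / (r.factorial : ℚ)) m := by
  classical
  have hcard : Nat.card {σ : Equiv.Perm α // CycQR q r σ} ≤ ∑ p : m.Partition,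
      (Finset.univ.filter fun σ : Equiv.Perm α =>
        σ.cycleType = r • p.parts.map (q * ·)).card := by
    rw [Nat.card_eq_fintype_card, Fintype.card_subtype]
    refine (Finset.card_le_card fun σ hσ => ?_).trans Finset.card_biUnion_le
    simpa using (Finset.mem_filter.1 hσ).2.exists_partition hq hr hα
  calc _ ≤ ((m * q) ^ (r - 1) * q : ℚ) * (∑ p : m.Partition,
        (Finset.univ.filter fun σ : Equiv.Perm α =>
          σ.cycleType = r • p.parts.map (q * ·)).card : ℕ) := by gcongr
    _ ≤ _ := by
      rw [Nat.cast_sum, Finset.mul_sum, cycleIndex, Finset.mul_sum]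
      exact Finset.sum_le_sum fun p _ => card_cycleType_nsmul_le hq hr hm hα p

end CycBound

/-- for `q ≥ 2`, `r = q^l`, `l ≥ 1`, `m ≥ 1`:
`|Reg_q(mqr)| > (mq)^{r-1} · |Cyc_{q,r}(mqr)|`. -/
theorem stmt16 (q l r m : ℕ) (hq : 2 ≤ q) (hl : 1 ≤ l) (hr : r = q ^ l) (hm : 1 ≤ m) :
    Nat.card {σ : Equiv.Perm (Fin (m * q * r)) //
        ∀ x, ¬ q ∣ Function.minimalPeriod ⇑σ x} >
      (m * q) ^ (r - 1) *
        Nat.card {σ : Equiv.Perm (Fin (m * q * r)) // CycQR q r σ} := by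
  have hr2 : 2 ≤ r := hr ▸ hq.trans (Nat.le_self_pow (by lia) q)
  have hreg := card_regular (α := Fin (m * q * r)) q
  have hcyc := card_cycQR_le (α := Fin (m * q * r)) hq hr2 hm (Fintype.card_fin _)
  rw [Fintype.card_fin] at hreg hcyc
  rw [cycleIndex_regWeight hq, show m * q * r / q = m * r by
    rw [mul_right_comm, Nat.mul_div_cancel _ (by lia)]] at hreg
  have hlt := mul_lt_mul_of_pos_left (cycleIndex_const_lt_regProd hq hr2 hm)
    (by positivity : (0 : ℚ) < (m * q * r).factorial)
  have hq0 : (0 : ℚ) < q := by positivity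
  rw [mul_left_comm, ← hreg] at hlt
  have h := hcyc.trans_lt hlt
  rw [mul_right_comm, mul_comm _ (q : ℚ)] at h
  exact_mod_cast lt_of_mul_lt_mul_left h hq0.le
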